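/- arXiv:math/0106245 — 2 statements merged into one kernel-verified Lean document; each statement's English description precedes it below -/
import Mathlib

section
/- Fix a prime p and a natural number n. Let μ be an additive Haar measure on V = Fin n → ℚ_p, let U ⊆ V be a compact open set, O ⊇ U open, and f : V → ℚ_p analytic on O. Let Cr = {x ∈ U : fderiv ℚ_p f x = 0} and suppose Cr is finite and every x₀ ∈ Cr is nondegenerate, meaning the second derivative H(x₀) = fderiv ℚ_p (fderiv ℚ_p f) x₀, viewed as a bilinear form on V, satisfies: for every v ≠ 0 there is w with H(x₀)(v)(w) ≠ 0. Let ψ : ℚ_p → ℂ be a continuous nontrivial additive character. Then there exist C > 0 and constants c : Cr → ℂ such that for every a ∈ ℚ_pˣ with ‖a‖ ≥ C, ∫_{x ∈ U} ψ( a² · f(x) ) dμ(x) = ∑_{x₀ ∈ Cr} ψ( a² · f(x₀) ) · ‖a‖^{−n} · c(x₀). -/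
open MeasureTheory Set Topology Metric Filter
open scoped Pointwise

theorem FormalMultilinearSeries.exists_nnnorm_changeOrigin_le {𝕜 E F : Type*}
    [NontriviallyNormedField 𝕜] [NormedAddCommGroup E] [NormedSpace 𝕜 E] [NormedAddCommGroup F]
    [NormedSpace 𝕜 F] [CompleteSpace F] (q : FormalMultilinearSeries 𝕜 E F) {r r' : NNReal}
    (h : (r + r' : ENNReal) < q.radius) :
    ∃ A : ℕ → NNReal, (Summable fun k ↦ A k * r' ^ k) ∧
      ∀ u : E, ‖u‖₊ ≤ r → ∀ k, ‖q.changeOrigin u k‖₊ ≤ A k := by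
  have hr : (r : ENNReal) < q.radius := lt_of_le_of_lt le_self_add h
  refine ⟨fun k ↦ ∑' s : Σ l : ℕ, { s : Finset (Fin (k + l)) // s.card = l },
    ‖q (k + s.1)‖₊ * r ^ s.1, ?_, fun u hu k ↦ ?_⟩
  · refine ((NNReal.summable_sigma.1 (q.changeOriginSeries_summable_aux₁ h)).2).congr fun k ↦ ?_
    simp only [NNReal.tsum_mul_right]
  · have hu' : (‖u‖₊ : ENNReal) < q.radius := (ENNReal.coe_le_coe.2 hu).trans_lt hr
    refine (q.nnnorm_changeOrigin_le k hu').trans ?_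
    refine Summable.tsum_le_tsum (fun s ↦ ?_) (q.changeOriginSeries_summable_aux₂ hu' k)
      (q.changeOriginSeries_summable_aux₂ hr k)
    gcongr

theorem AnalyticAt.exists_norm_taylor_one_le {𝕜 E F : Type*} [NontriviallyNormedField 𝕜]
    [NormedAddCommGroup E] [NormedSpace 𝕜 E] [NormedAddCommGroup F] [NormedSpace 𝕜 F]
    [CompleteSpace F] {f : E → F} {x : E} (hf : AnalyticAt 𝕜 f x) :
    ∃ M : ℝ, ∃ ρ > 0, ∀ y ∈ ball x ρ, ∀ h : E, ‖h‖ ≤ ρ →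
      ‖f (y + h) - f y - fderiv 𝕜 f y h‖ ≤ M * ‖h‖ ^ 2 := by
  obtain ⟨q, r, hq⟩ := hf
  obtain ⟨r₁, hr₁, hr₁r⟩ := ENNReal.lt_iff_exists_nnreal_btwn.1 hq.r_pos
  obtain ⟨ρ, hρ⟩ : ∃ ρ : NNReal, ρ = r₁ / 2 := ⟨_, rfl⟩
  have hρ0 : 0 < ρ := hρ ▸ half_pos (by exact_mod_cast hr₁)
  have hadd : (ρ : ENNReal) + ρ < r := by
    rw [← ENNReal.coe_add, hρ, add_halves]; exact hr₁r
  obtain ⟨A, hAsum, hA⟩ := q.exists_nnnorm_changeOrigin_le (hadd.trans_le hq.r_le)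
  have hAsum' : Summable fun k ↦ A (k + 2) * ρ ^ k := by
    have := (NNReal.summable_nat_add _ hAsum 2).mul_right ((ρ ^ 2)⁻¹)
    refine this.congr fun k ↦ ?_
    rw [pow_add, ← mul_assoc, mul_inv_cancel_right₀ (pow_pos hρ0 2).ne']
  refine ⟨(∑' k, A (k + 2) * ρ ^ k : NNReal), ρ, by exact_mod_cast hρ0, fun y hy h hh ↦ ?_⟩
  obtain ⟨u, rfl⟩ : ∃ u, y = x + u := ⟨y - x, by abel⟩
  have hu : ‖u‖₊ ≤ ρ := by
    have : ‖u‖ < ρ := by simpa using hy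
    exact_mod_cast this.le
  have hh' : ‖h‖₊ ≤ ρ := by exact_mod_cast hh
  have hur : (‖u‖₊ : ENNReal) < r := by
    refine lt_of_le_of_lt ?_ hadd
    exact (ENNReal.coe_le_coe.2 hu).trans le_self_add
  have hqu := hq.changeOrigin hur
  have hcoef := hA u hu
  have hhs : HasSum (fun k ↦ q.changeOrigin u k fun _ ↦ h) (f (x + u + h)) := by
    refine hqu.hasSum ?_
    rw [Metric.mem_eball, edist_zero_right, lt_tsub_iff_right]
    refine lt_of_le_of_lt ?_ hadd
    exact add_le_add (by exact_mod_cast hh') (by exact_mod_cast hu)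
  have hd : fderiv 𝕜 f (x + u) h = q.changeOrigin u 1 fun _ ↦ h := by
    rw [hqu.hasFPowerSeriesAt.fderiv_eq]
    simp only [continuousMultilinearCurryFin1_apply]
    congr 1
  have h0 : f (x + u) = q.changeOrigin u 0 fun _ ↦ h := by
    rw [hqu.coeff_zero]
  have htail := (hasSum_nat_add_iff' 2).2 hhs
  have hval : f (x + u + h) - f (x + u) - fderiv 𝕜 f (x + u) h =
      ∑' k, q.changeOrigin u (k + 2) fun _ ↦ h := by
    rw [htail.tsum_eq, Finset.sum_range_succ, Finset.sum_range_one, hd, h0]; abel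
  rw [hval]
  have hb : ∀ k, ‖q.changeOrigin u (k + 2) fun _ ↦ h‖ ≤ (A (k + 2) * ρ ^ k : NNReal) * ‖h‖ ^ 2 := by
    intro k
    have h1 := (q.changeOrigin u (k + 2)).le_opNorm (fun _ ↦ h)
    have h2 : ‖q.changeOrigin u (k + 2)‖ ≤ A (k + 2) := by exact_mod_cast hcoef (k + 2)
    refine h1.trans ?_
    rw [Finset.prod_const, Finset.card_univ, Fintype.card_fin, pow_add, ← mul_assoc]
    push_cast
    gcongr
  refine (tsum_of_norm_bounded ?_ hb)
  have := (NNReal.hasSum_coe.2 hAsum'.hasSum).mul_right (‖h‖ ^ 2)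
  simpa only [NNReal.coe_mul, NNReal.coe_pow] using this

theorem AnalyticAt.exists_norm_taylor_two_le {𝕜 E F : Type*} [NontriviallyNormedField 𝕜]
    [NormedAddCommGroup E] [NormedSpace 𝕜 E] [NormedAddCommGroup F] [NormedSpace 𝕜 F]
    {f : E → F} {x : E} (hf : AnalyticAt 𝕜 f x) :
    ∃ q : E [×2]→L[𝕜] F, ∃ M : ℝ, ∃ ρ > 0, ∀ h : E, ‖h‖ ≤ ρ →
      ‖f (x + h) - f x - fderiv 𝕜 f x h - q fun _ ↦ h‖ ≤ M * ‖h‖ ^ 3 := by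
  obtain ⟨q, hq⟩ := hf
  obtain ⟨M, hM⟩ := (hq.isBigO_sub_partialSum_pow 3).bound
  obtain ⟨ρ, hρ, hball⟩ := Metric.eventually_nhds_iff_ball.1 hM
  refine ⟨q 2, M, ρ / 2, half_pos hρ, fun h hh ↦ ?_⟩
  have := hball h (by rw [mem_ball_zero_iff]; linarith)
  have hd : fderiv 𝕜 f x h = q 1 fun _ ↦ h := by
    rw [hq.fderiv_eq]
    simp only [continuousMultilinearCurryFin1_apply]
    congr 1
  rw [hd, ← hq.coeff_zero fun _ ↦ h]
  simpa [FormalMultilinearSeries.partialSum, Finset.sum_range_succ, sub_sub, add_assoc] using this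

theorem Complex.eq_one_of_forall_norm_pow_sub_one_le {z : ℂ}
    (h : ∀ k : ℕ, ‖z ^ k - 1‖ ≤ 1 / 2) : z = 1 := by
  have key : ∀ m : ℕ, (3 / 2 : ℝ) ^ m * ‖z - 1‖ ≤ ‖z ^ 2 ^ m - 1‖ := by
    intro m
    induction m with
    | zero => simp
    | succ m ih =>
      have h1 : z ^ 2 ^ (m + 1) - 1 = (z ^ 2 ^ m - 1) * (z ^ 2 ^ m + 1) := by ring
      have h2 : 3 / 2 ≤ ‖z ^ 2 ^ m + 1‖ := by
        have h3 := norm_sub_norm_le (2 : ℂ) (-(z ^ 2 ^ m - 1))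
        have h4 : (2 : ℂ) - -(z ^ 2 ^ m - 1) = z ^ 2 ^ m + 1 := by ring
        rw [h4, norm_neg, Complex.norm_ofNat] at h3
        linarith [h (2 ^ m)]
      rw [h1, norm_mul, pow_succ]
      nlinarith [norm_nonneg (z - 1), norm_nonneg (z ^ 2 ^ m - 1)]
  by_contra hz
  have hpos : 0 < ‖z - 1‖ := norm_pos_iff.2 (sub_ne_zero.2 hz)
  obtain ⟨m, hm⟩ := pow_unbounded_of_one_lt (1 / ‖z - 1‖) (by norm_num : (1 : ℝ) < 3 / 2)
  rw [div_lt_iff₀ hpos] at hm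
  linarith [key m, h (2 ^ m)]

theorem AddChar.exists_forall_norm_le_eq_one {A : Type*} [SeminormedAddCommGroup A]
    [IsUltrametricDist A] (ψ : AddChar A ℂ) (hψ : Continuous ψ) :
    ∃ τ > 0, ∀ t : A, ‖t‖ ≤ τ → ψ t = 1 := by
  have h := Metric.continuousAt_iff.1 (hψ.continuousAt (x := 0)) (1 / 2) (by norm_num)
  obtain ⟨δ, hδ, hball⟩ := h
  refine ⟨δ / 2, half_pos hδ, fun t ht ↦ Complex.eq_one_of_forall_norm_pow_sub_one_le fun k ↦ ?_⟩
  rw [← ψ.map_nsmul_eq_pow]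
  have hk : ‖k • t‖ ≤ ‖t‖ := by
    induction k with
    | zero => simp
    | succ k ih =>
      rw [succ_nsmul]
      exact (IsUltrametricDist.norm_add_le_max _ _).trans (max_le ih le_rfl)
  have := hball (x := k • t) (by rw [dist_zero_right]; linarith)
  rw [ψ.map_zero_eq_one, dist_eq_norm] at this
  exact this.le

/-- If on every ball of radius `κ` some translation by a vector of norm at most `κ` multiplies `G`
by a constant other than `1`, then `G` has integral zero. -/
theorem MeasureTheory.integral_eq_zero_of_forall_exists_eq_mul {E : Type*}
    [NormedAddCommGroup E] [ProperSpace E] [IsUltrametricDist E] [MeasurableSpace E]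
    [BorelSpace E] {μ : Measure E} [μ.IsAddHaarMeasure] {G : E → ℂ} (hG : Continuous G)
    (hGc : HasCompactSupport G) {κ : ℝ} (hκ : 0 < κ)
    (h : ∀ y, ∃ h₀ : E, ‖h₀‖ ≤ κ ∧ ∃ ζ : ℂ, ζ ≠ 1 ∧
      ∀ h : E, ‖h‖ ≤ κ → G (y + (h + h₀)) = ζ * G (y + h)) :
    ∫ y, G y ∂μ = 0 := by
  set K : Set E := closedBall 0 κ with hK
  have hKo : IsOpen K := IsUltrametricDist.isOpen_closedBall 0 hκ.ne'
  have hKc : IsCompact K := isCompact_closedBall 0 κ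
  set χ : E → ℂ := K.indicator 1 with hχ
  have hKcl : IsClopen K := ⟨hKc.isClosed, hKo⟩
  have hχc : Continuous χ := continuous_one.indicator (by simp [hKcl.frontier_eq])
  set Φ : E → E → ℂ := fun y k ↦ χ k * G (y + k) with hΦ
  have hΦc : Continuous Φ.uncurry :=
    (hχc.comp continuous_snd).mul (hG.comp (continuous_fst.add continuous_snd))
  have hΦs : HasCompactSupport Φ.uncurry := by
    refine HasCompactSupport.intro (K := (fun z : E × E ↦ (z.1 - z.2, z.2)) '' (tsupport G ×ˢ K))
      ((hGc.isCompact.prod hKc).image (by fun_prop)) ?_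
    rintro ⟨y, k⟩ hyk
    by_contra hne
    refine hyk ⟨(y + k, k), ⟨subset_tsupport _ ?_, ?_⟩, by simp⟩
    · exact right_ne_zero_of_mul hne
    · by_contra hk
      exact left_ne_zero_of_mul hne (indicator_of_notMem hk _)
  have hswap := integral_integral_swap_of_hasCompactSupport hΦc hΦs (μ := μ) (ν := μ)
  have hleft : ∀ y, ∫ k, Φ y k ∂μ = 0 := by
    intro y
    obtain ⟨h₀, hh₀, ζ, hζ, hmul⟩ := h y
    have h1 : ∫ k, Φ y k ∂μ = ζ * ∫ k, Φ y k ∂μ := by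
      rw [← integral_const_mul, ← integral_add_right_eq_self _ h₀]
      refine integral_congr_ae (Filter.Eventually.of_forall fun k ↦ ?_)
      by_cases hk : ‖k‖ ≤ κ
      · have hk' : ‖k + h₀‖ ≤ κ :=
          (IsUltrametricDist.norm_add_le_max _ _).trans (max_le hk hh₀)
        simp [hΦ, hχ, hK, hk, hk', hmul k hk]
      · have hk' : ¬ ‖k + h₀‖ ≤ κ := fun hk' ↦ hk <| by
          have := (IsUltrametricDist.norm_add_le_max (k + h₀) (-h₀)).trans
            (max_le hk' (by rwa [norm_neg]))
          simpa using this
        simp [hΦ, hχ, hK, hk, hk']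
    have h2 : (1 - ζ) * ∫ k, Φ y k ∂μ = 0 := by linear_combination h1
    exact (mul_eq_zero.1 h2).resolve_left (sub_ne_zero.2 hζ.symm)
  have hright : ∀ k, ∫ y, Φ y k ∂μ = χ k * ∫ y, G y ∂μ := by
    intro k
    rw [integral_const_mul, integral_add_right_eq_self]
  simp_rw [hleft, hright, integral_zero, integral_mul_const] at hswap
  refine (mul_eq_zero.1 hswap.symm).resolve_left ?_
  rw [hχ, integral_indicator hKc.measurableSet]
  have hpos : 0 < μ.real K :=
    ENNReal.toReal_pos (hKo.measure_pos μ ⟨0, mem_closedBall_self hκ.le⟩).ne'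
      hKc.measure_lt_top.ne
  simpa using hpos.ne'

namespace Padic

variable {p : ℕ} [Fact p.Prime]

theorem norm_natCast_sub_natCast_eq_one {i j : ℕ} (hi : i < p) (hj : j < p) (hij : i ≠ j) :
    ‖(i - j : ℚ_[p])‖ = 1 := by
  have h : ‖((i - j : ℤ) : ℚ_[p])‖ = 1 := by
    refine le_antisymm (Padic.norm_int_le_one _) (not_lt.1 fun hlt ↦ ?_)
    rw [Padic.norm_intCast_lt_one_iff] at hlt
    have := Int.eq_zero_of_abs_lt_dvd hlt (abs_lt.2 ⟨by omega, by omega⟩)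
    omega
  simpa using h

theorem exists_natCast_norm_sub_le {x : ℚ_[p]} (hx : ‖x‖ ≤ 1) :
    ∃ i : Fin p, ‖x - (i : ℕ)‖ ≤ (p : ℝ)⁻¹ := by
  set y : ℤ_[p] := ⟨x, hx⟩
  refine ⟨⟨y.zmodRepr, y.zmodRepr_lt_p⟩, ?_⟩
  have h := y.norm_sub_zmodRepr_lt_one
  have h' : ‖y - y.zmodRepr‖ ≤ (p : ℝ) ^ (-(1 : ℤ)) :=
    (PadicInt.norm_le_pow_iff_norm_lt_pow_add_one _ _).2 (by simpa using h)
  rw [PadicInt.norm_def, zpow_neg_one] at h'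
  simpa only [PadicInt.coe_sub, PadicInt.coe_natCast] using h'

variable (p) in
theorem closedBall_eq_iUnion_vadd (n : ℕ) :
    closedBall (0 : Fin n → ℚ_[p]) 1 = ⋃ v : Fin n → Fin p,
      (fun i ↦ ((v i : ℕ) : ℚ_[p])) +ᵥ closedBall (0 : Fin n → ℚ_[p]) (p : ℝ)⁻¹ := by
  have hp : (0 : ℝ) ≤ (p : ℝ)⁻¹ := by positivity
  have hp1 : (p : ℝ)⁻¹ ≤ 1 :=
    inv_le_one_of_one_le₀ (by exact_mod_cast (Fact.out : p.Prime).one_le)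
  ext x
  simp only [mem_iUnion, mem_vadd_set_iff_neg_vadd_mem, mem_closedBall_zero_iff, vadd_eq_add,
    pi_norm_le_iff_of_nonneg hp, pi_norm_le_iff_of_nonneg zero_le_one, Pi.add_apply, Pi.neg_apply]
  constructor
  · intro hx
    choose v hv using fun i ↦ exists_natCast_norm_sub_le (hx i)
    exact ⟨v, fun i ↦ by rw [neg_add_eq_sub]; exact hv i⟩
  · rintro ⟨v, hv⟩ i
    have h1 : x i = (v i : ℕ) + (-((v i : ℕ) : ℚ_[p]) + x i) := by ring
    rw [h1]
    refine (Padic.nonarchimedean _ _).trans (max_le ?_ ((hv i).trans hp1))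
    exact_mod_cast Padic.norm_int_le_one ((v i : ℕ) : ℤ)

theorem pairwise_disjoint_vadd_closedBall (n : ℕ) :
    Pairwise (Function.onFun Disjoint fun v : Fin n → Fin p ↦
      (fun i ↦ ((v i : ℕ) : ℚ_[p])) +ᵥ closedBall (0 : Fin n → ℚ_[p]) (p : ℝ)⁻¹) := by
  have hp : (0 : ℝ) ≤ (p : ℝ)⁻¹ := by positivity
  have hp1 : (p : ℝ)⁻¹ < 1 :=
    inv_lt_one_of_one_lt₀ (by exact_mod_cast (Fact.out : p.Prime).one_lt)
  intro v w hvw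
  refine Set.disjoint_left.2 fun x hx hx' ↦ hvw (funext fun i ↦ ?_)
  simp only [mem_vadd_set_iff_neg_vadd_mem, mem_closedBall_zero_iff, vadd_eq_add,
    pi_norm_le_iff_of_nonneg hp, Pi.add_apply, Pi.neg_apply] at hx hx'
  by_contra hne
  have h1 := norm_natCast_sub_natCast_eq_one (v i).2 (w i).2 (fun h ↦ hne (Fin.ext h))
  have h2 : (((v i : ℕ) : ℚ_[p]) - (w i : ℕ)) =
      (-((w i : ℕ) : ℚ_[p]) + x i) + -(-((v i : ℕ) : ℚ_[p]) + x i) := by ring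
  have h3 : ‖((v i : ℕ) : ℚ_[p]) - (w i : ℕ)‖ ≤ (p : ℝ)⁻¹ := by
    rw [h2]
    exact (Padic.nonarchimedean _ _).trans (max_le (hx' i) (by rw [norm_neg]; exact hx i))
  linarith

theorem units_smul_closedBall {n : ℕ} (a : ℚ_[p]ˣ) (r : ℝ) :
    a • closedBall (0 : Fin n → ℚ_[p]) r = closedBall 0 (‖(a : ℚ_[p])‖ * r) := by
  have ha : 0 < ‖(a : ℚ_[p])‖ := norm_pos_iff.2 a.ne_zero
  ext x
  rw [mem_smul_set_iff_inv_smul_mem, mem_closedBall_zero_iff, mem_closedBall_zero_iff,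
    Units.smul_def, norm_smul, Units.val_inv_eq_inv_val, norm_inv, inv_mul_le_iff₀ ha]

/-- Scaling by `a` multiplies Haar measure on `ℚ_[p] ^ n` by `‖a‖ ^ n`. -/
theorem distribHaarChar_pi (n : ℕ) (a : ℚ_[p]ˣ) :
    distribHaarChar (Fin n → ℚ_[p]) a = ‖(a : ℚ_[p])‖₊ ^ n := by
  borelize (Fin n → ℚ_[p])
  set μ : Measure (Fin n → ℚ_[p]) := Measure.addHaar
  set B : Set (Fin n → ℚ_[p]) := closedBall 0 1
  have hB₀ : μ B ≠ 0 := (measure_closedBall_pos μ 0 one_pos).ne'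
  have hB : μ B ≠ ⊤ := (isCompact_closedBall _ _).measure_lt_top.ne
  have hp0 : (p : ℚ_[p]) ≠ 0 := by exact_mod_cast (Fact.out : p.Prime).ne_zero
  have hpn : (p : NNReal) ≠ 0 := by exact_mod_cast (Fact.out : p.Prime).ne_zero
  have hunit : ∀ u : ℚ_[p]ˣ, ‖(u : ℚ_[p])‖ = 1 → distribHaarChar (Fin n → ℚ_[p]) u = 1 := by
    intro u hu
    refine distribHaarChar_eq_of_measure_smul_eq_mul (μ := μ) hB₀ hB ?_
    rw [units_smul_closedBall, hu, one_mul, ENNReal.coe_one, one_mul]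
  have hprime : distribHaarChar (Fin n → ℚ_[p]) (Units.mk0 (p : ℚ_[p]) hp0) =
      (p : NNReal)⁻¹ ^ n := by
    refine distribHaarChar_eq_of_measure_smul_eq_mul (μ := μ) hB₀ hB ?_
    have h1 : μ B = (p : ENNReal) ^ n * μ (Units.mk0 (p : ℚ_[p]) hp0 • B) := by
      rw [units_smul_closedBall, Units.val_mk0, Padic.norm_p, mul_one]
      conv_lhs => rw [show B = _ from closedBall_eq_iUnion_vadd p n]
      rw [measure_iUnion (pairwise_disjoint_vadd_closedBall n)
        fun v ↦ isClosed_closedBall.measurableSet.const_vadd _]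
      simp only [measure_vadd]
      simp
    rw [h1, ← mul_assoc, ENNReal.coe_pow, ENNReal.coe_inv hpn, ← mul_pow, ENNReal.coe_natCast,
      ENNReal.inv_mul_cancel (by exact_mod_cast hpn) (ENNReal.natCast_ne_top p), one_pow, one_mul]
  set k := (a : ℚ_[p]).valuation
  have ha : ‖(a : ℚ_[p])‖ = (p : ℝ) ^ (-k) := Padic.norm_eq_zpow_neg_valuation a.ne_zero
  have hu := hunit (a * Units.mk0 (p : ℚ_[p]) hp0 ^ (-k)) (by
    have : (p : ℝ) ≠ 0 := by exact_mod_cast hpn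
    rw [Units.val_mul, norm_mul, ha, Units.val_zpow_eq_zpow_val, norm_zpow, Units.val_mk0,
      Padic.norm_p, inv_zpow, mul_inv_cancel₀ (zpow_ne_zero _ this)])
  have hnn : ‖(a : ℚ_[p])‖₊ = (p : NNReal) ^ (-k) := by
    ext; simpa using ha
  rw [map_mul, map_zpow, hprime] at hu
  rw [hnn, eq_inv_of_mul_eq_one_left hu, ← zpow_neg, neg_neg, inv_pow, ← zpow_natCast, inv_zpow',
    ← zpow_natCast, ← zpow_mul, ← zpow_mul, mul_comm]

theorem integral_comp_inv_smul {n : ℕ} [MeasurableSpace (Fin n → ℚ_[p])]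
    [BorelSpace (Fin n → ℚ_[p])] (μ : Measure (Fin n → ℚ_[p])) [μ.IsAddHaarMeasure]
    (a : ℚ_[p]ˣ) (F : (Fin n → ℚ_[p]) → ℂ) :
    ∫ z, F (a⁻¹ • z) ∂μ = (‖(a : ℚ_[p])‖ : ℂ) ^ n * ∫ z, F z ∂μ := by
  have hmap : μ.map (a⁻¹ • ·) = (‖(a : ℚ_[p])‖₊ ^ n) • μ := by
    ext s hs
    rw [Measure.map_apply (measurable_const_smul _) hs, preimage_smul_inv,
      ← distribHaarChar_mul, distribHaarChar_pi]
    rfl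
  rw [← (measurableEmbedding_const_smul a⁻¹).integral_map F, hmap, integral_smul_nnreal_measure]
  rw [NNReal.smul_def]
  simp

end Padic

theorem IsCompact.exists_norm_taylor_one_le {𝕜 E F : Type*} [NontriviallyNormedField 𝕜]
    [NormedAddCommGroup E] [NormedSpace 𝕜 E] [NormedAddCommGroup F] [NormedSpace 𝕜 F]
    [CompleteSpace F] {f : E → F} {U : Set E} (hUc : IsCompact U) (hUo : IsOpen U)
    (hf : AnalyticOnNhd 𝕜 f U) :
    ∃ M > 0, ∃ ρ > 0, ∀ y ∈ U, ∀ h : E, ‖h‖ ≤ ρ →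
      y + h ∈ U ∧ ‖f (y + h) - f y - fderiv 𝕜 f y h‖ ≤ M * ‖h‖ ^ 2 := by
  refine hUc.induction_on (p := fun S ↦ ∃ M > 0, ∃ ρ > 0, ∀ y ∈ S, ∀ h : E, ‖h‖ ≤ ρ →
      y + h ∈ U ∧ ‖f (y + h) - f y - fderiv 𝕜 f y h‖ ≤ M * ‖h‖ ^ 2)
    ⟨1, one_pos, 1, one_pos, by simp⟩ ?_ ?_ ?_
  · rintro S T hST ⟨M, hM, ρ, hρ, h⟩
    exact ⟨M, hM, ρ, hρ, fun y hy ↦ h y (hST hy)⟩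
  · rintro S T ⟨M, hM, ρ, hρ, hS⟩ ⟨M', hM', ρ', hρ', hT⟩
    refine ⟨max M M', lt_max_of_lt_left hM, min ρ ρ', lt_min hρ hρ', fun y hy h hh ↦ ?_⟩
    rcases hy with hy | hy
    · obtain ⟨h1, h2⟩ := hS y hy h (hh.trans (min_le_left _ _))
      exact ⟨h1, h2.trans (by gcongr; exact le_max_left _ _)⟩
    · obtain ⟨h1, h2⟩ := hT y hy h (hh.trans (min_le_right _ _))
      exact ⟨h1, h2.trans (by gcongr; exact le_max_right _ _)⟩
  · intro x hx
    obtain ⟨M, ρ, hρ, h⟩ := (hf x hx).exists_norm_taylor_one_le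
    obtain ⟨ε, hε, hball⟩ := Metric.isOpen_iff.1 hUo x hx
    refine ⟨ball x (min ρ (ε / 2)), mem_nhdsWithin_of_mem_nhds
      (ball_mem_nhds _ (lt_min hρ (half_pos hε))), max M 1, by positivity,
      min ρ (ε / 3), by positivity, fun y hy k hk ↦ ⟨hball ?_, ?_⟩⟩
    · rw [mem_ball] at hy ⊢
      have h1 := dist_triangle (y + k) y x
      rw [dist_self_add_left] at h1
      linarith [min_le_right ρ (ε / 2), min_le_right ρ (ε / 3)]
    · refine (h y (ball_subset_ball (min_le_left _ _) hy) k (hk.trans (min_le_left _ _))).trans ?_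
      gcongr
      exact le_max_left _ _

/-- Away from nondegenerate critical points, the derivative is bounded below linearly in the
distance to the critical set. -/
theorem IsCompact.exists_mul_le_norm_fderiv {𝕜 E F : Type*} [NontriviallyNormedField 𝕜]
    [CompleteSpace 𝕜] [NormedAddCommGroup E] [NormedSpace 𝕜 E] [FiniteDimensional 𝕜 E]
    [NormedAddCommGroup F] [NormedSpace 𝕜 F] [CompleteSpace F] {f : E → F} {U : Set E}
    (hUc : IsCompact U) (hf : AnalyticOnNhd 𝕜 f U)
    (hnd : ∀ x ∈ U, fderiv 𝕜 f x = 0 → Function.Injective (fderiv 𝕜 (fderiv 𝕜 f) x)) :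
    ∃ c > 0, ∀ y ∈ U, ∀ δ : ℝ, 0 ≤ δ → δ ≤ 1 →
      (∀ x ∈ U, fderiv 𝕜 f x = 0 → δ < ‖y - x‖) → c * δ ≤ ‖fderiv 𝕜 f y‖ := by
  refine hUc.induction_on (p := fun S ↦ ∃ c > 0, ∀ y ∈ S, ∀ δ : ℝ, 0 ≤ δ → δ ≤ 1 →
      (∀ x ∈ U, fderiv 𝕜 f x = 0 → δ < ‖y - x‖) → c * δ ≤ ‖fderiv 𝕜 f y‖)
    ⟨1, one_pos, by simp⟩ ?_ ?_ ?_
  · rintro S T hST ⟨c, hc, h⟩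
    exact ⟨c, hc, fun y hy ↦ h y (hST hy)⟩
  · rintro S T ⟨c, hc, hS⟩ ⟨c', hc', hT⟩
    refine ⟨min c c', lt_min hc hc', fun y hy δ h0 h1 hδ ↦ ?_⟩
    rcases hy with hy | hy
    · exact le_trans (by gcongr; exact min_le_left _ _) (hS y hy δ h0 h1 hδ)
    · exact le_trans (by gcongr; exact min_le_right _ _) (hT y hy δ h0 h1 hδ)
  · intro x hx
    by_cases hx0 : fderiv 𝕜 f x = 0
    · obtain ⟨K, hK, hanti⟩ := LinearMap.exists_antilipschitzWith
        (fderiv 𝕜 (fderiv 𝕜 f) x : E →ₗ[𝕜] E →L[𝕜] F) (LinearMap.ker_eq_bot.2 (hnd x hx hx0))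
      have hK' : (0 : ℝ) < K := hK
      have hd := (hf x hx).fderiv.differentiableAt.hasFDerivAt.isLittleO.def
        (show (0 : ℝ) < 1 / (2 * K) by positivity)
      refine ⟨_, mem_nhdsWithin_of_mem_nhds hd, 1 / (2 * K), by positivity,
        fun y hy δ h0 h1 hδ ↦ ?_⟩
      have hy' : ‖fderiv 𝕜 f y - fderiv 𝕜 f x - fderiv 𝕜 (fderiv 𝕜 f) x (y - x)‖ ≤
        1 / (2 * K) * ‖y - x‖ := hy
      rw [hx0, sub_zero] at hy'
      have hH : ‖y - x‖ ≤ K * ‖fderiv 𝕜 (fderiv 𝕜 f) x (y - x)‖ := by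
        simpa using hanti.le_mul_dist (y - x) 0
      have hH' : 1 / K * ‖y - x‖ ≤ ‖fderiv 𝕜 (fderiv 𝕜 f) x (y - x)‖ := by
        rwa [one_div, inv_mul_le_iff₀ hK']
      have htri := norm_sub_norm_le (fderiv 𝕜 (fderiv 𝕜 f) x (y - x)) (fderiv 𝕜 f y)
      rw [norm_sub_rev] at htri
      have hsplit : 1 / K * ‖y - x‖ = 1 / (2 * K) * ‖y - x‖ + 1 / (2 * K) * ‖y - x‖ := by
        field_simp; ring
      have hlt : 1 / (2 * K) * δ ≤ 1 / (2 * K) * ‖y - x‖ := by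
        gcongr; exact (hδ x hx hx0).le
      linarith
    · have hpos : 0 < ‖fderiv 𝕜 f x‖ := norm_pos_iff.2 hx0
      have hev := (hf x hx).fderiv.continuousAt.norm.eventually (lt_mem_nhds (half_lt_self hpos))
      refine ⟨_, mem_nhdsWithin_of_mem_nhds hev, ‖fderiv 𝕜 f x‖ / 2, half_pos hpos,
        fun y hy δ h0 h1 _ ↦ ?_⟩
      have hy' : ‖fderiv 𝕜 f x‖ / 2 < ‖fderiv 𝕜 f y‖ := hy
      nlinarith

namespace Padic

variable {p : ℕ} [Fact p.Prime] {n : ℕ} [MeasurableSpace (Fin n → ℚ_[p])]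
  [BorelSpace (Fin n → ℚ_[p])]

theorem tendsto_div_norm_units (R : ℝ) :
    Tendsto (fun a : ℚ_[p]ˣ ↦ R / ‖(a : ℚ_[p])‖)
      (comap (fun a : ℚ_[p]ˣ ↦ ‖(a : ℚ_[p])‖) atTop) (𝓝 0) :=
  tendsto_const_nhds.div_atTop tendsto_comap

/-- The contribution of a ball of radius `R / ‖a‖` around a critical point. -/
theorem exists_eventually_setIntegral_closedBall_eq (μ : Measure (Fin n → ℚ_[p]))
    [μ.IsAddHaarMeasure] {f : (Fin n → ℚ_[p]) → ℚ_[p]} {x₀ : Fin n → ℚ_[p]}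
    (hf : AnalyticAt ℚ_[p] f x₀) (hx₀ : fderiv ℚ_[p] f x₀ = 0) (ψ : AddChar ℚ_[p] ℂ)
    (hψ : Continuous ψ) {R : ℝ} (hR : 0 < R) :
    ∃ c : ℂ, ∀ᶠ a : ℚ_[p]ˣ in comap (fun a : ℚ_[p]ˣ ↦ ‖(a : ℚ_[p])‖) atTop,
      ∫ x in closedBall x₀ (R / ‖(a : ℚ_[p])‖), ψ ((a : ℚ_[p]) ^ 2 * f x) ∂μ =
        ψ ((a : ℚ_[p]) ^ 2 * f x₀) * ((‖(a : ℚ_[p])‖ : ℂ) ^ (-(n : ℤ))) * c := by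
  obtain ⟨τ, hτ, hψτ⟩ := ψ.exists_forall_norm_le_eq_one hψ
  obtain ⟨q, M, ρ, hρ, hq⟩ := hf.exists_norm_taylor_two_le
  refine ⟨∫ z in closedBall 0 R, ψ (q fun _ ↦ z) ∂μ, ?_⟩
  filter_upwards [(tendsto_div_norm_units R).eventually_le_const hρ,
    (tendsto_div_norm_units (|M| * R ^ 3)).eventually_le_const hτ] with a hRρ hMτ
  set N := ‖(a : ℚ_[p])‖ with hN
  have hN0 : 0 < N := norm_pos_iff.2 a.ne_zero
  have hNC : (N : ℂ) ≠ 0 := by exact_mod_cast hN0.ne'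
  set g : (Fin n → ℚ_[p]) → ℂ := fun x ↦ ψ ((a : ℚ_[p]) ^ 2 * f x)
  set F : (Fin n → ℚ_[p]) → ℂ := fun y ↦ (closedBall x₀ (R / N)).indicator g (x₀ + y)
  have hscale := integral_comp_inv_smul μ a F
  have hF : ∫ y, F y ∂μ = ∫ x in closedBall x₀ (R / N), g x ∂μ := by
    rw [integral_add_left_eq_self, integral_indicator isClosed_closedBall.measurableSet]
  have hpt : ∀ z, F (a⁻¹ • z) = ψ ((a : ℚ_[p]) ^ 2 * f x₀) *
      (closedBall 0 R).indicator (fun z ↦ ψ (q fun _ ↦ z)) z := by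
    intro z
    have hnorm : ‖a⁻¹ • z‖ = ‖z‖ / N := by
      rw [Units.smul_def, norm_smul, Units.val_inv_eq_inv_val, norm_inv, ← hN, inv_mul_eq_div]
    by_cases hz : ‖z‖ ≤ R
    · have hz' : ‖a⁻¹ • z‖ ≤ R / N := by rw [hnorm]; gcongr
      have hval : F (a⁻¹ • z) = g (x₀ + a⁻¹ • z) := indicator_of_mem (by simpa using hz') _
      rw [hval, indicator_of_mem (by simpa using hz)]
      have htay := hq (a⁻¹ • z) (hz'.trans hRρ)
      rw [hx₀, zero_apply, sub_zero] at htay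
      have hqz : (q fun _ ↦ a⁻¹ • z) = ((a : ℚ_[p])⁻¹) ^ 2 * q fun _ ↦ z := by
        have := q.map_smul_univ (fun _ ↦ (a : ℚ_[p])⁻¹) (fun _ ↦ z)
        simpa [Units.smul_def] using this
      set e := f (x₀ + a⁻¹ • z) - f x₀ - q fun _ ↦ a⁻¹ • z with he
      have hdecomp : (a : ℚ_[p]) ^ 2 * f (x₀ + a⁻¹ • z) =
          (a : ℚ_[p]) ^ 2 * f x₀ + (q fun _ ↦ z) + (a : ℚ_[p]) ^ 2 * e := by
        have ha : (a : ℚ_[p]) ≠ 0 := a.ne_zero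
        rw [he, hqz]
        field_simp
        ring
      have hsmall : ‖(a : ℚ_[p]) ^ 2 * e‖ ≤ τ := by
        rw [norm_mul, norm_pow, ← hN]
        calc N ^ 2 * ‖e‖ ≤ N ^ 2 * (|M| * (R / N) ^ 3) := by
              gcongr
              refine htay.trans ?_
              gcongr
              exact le_abs_self M
          _ = |M| * R ^ 3 / N := by field_simp
          _ ≤ τ := hMτ
      show ψ _ = _
      rw [hdecomp, ψ.map_add_eq_mul, ψ.map_add_eq_mul, hψτ _ hsmall, mul_one]
    · have hz' : ¬ ‖a⁻¹ • z‖ ≤ R / N := by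
        rw [hnorm, div_le_div_iff_of_pos_right hN0]; exact hz
      have hval : F (a⁻¹ • z) = 0 := indicator_of_notMem (by simpa using hz') _
      rw [hval, indicator_of_notMem (by simpa using hz), mul_zero]
  simp_rw [hpt] at hscale
  rw [integral_const_mul, integral_indicator isClosed_closedBall.measurableSet, hF] at hscale
  rw [zpow_neg, zpow_natCast, mul_right_comm, hscale, ← hN]
  field_simp

/-- The part of `U` at distance more than `R / ‖a‖` from the critical points contributes nothing. -/
theorem exists_eventually_setIntegral_diff_eq_zero (μ : Measure (Fin n → ℚ_[p]))
    [μ.IsAddHaarMeasure] {f : (Fin n → ℚ_[p]) → ℚ_[p]} {U : Set (Fin n → ℚ_[p])}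
    (hUc : IsCompact U) (hUo : IsOpen U) (hf : AnalyticOnNhd ℚ_[p] f U)
    (s : Finset (Fin n → ℚ_[p])) (hs : ∀ x, x ∈ s ↔ x ∈ U ∧ fderiv ℚ_[p] f x = 0)
    (hnd : ∀ x ∈ s, Function.Injective (fderiv ℚ_[p] (fderiv ℚ_[p] f) x))
    (ψ : AddChar ℚ_[p] ℂ) (hψ : Continuous ψ) (hψ1 : ∃ x, ψ x ≠ 1) :
    ∃ R > 0, ∀ᶠ a : ℚ_[p]ˣ in comap (fun a : ℚ_[p]ˣ ↦ ‖(a : ℚ_[p])‖) atTop,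
      ∫ x in U \ ⋃ x₀ ∈ s, closedBall x₀ (R / ‖(a : ℚ_[p])‖),
        ψ ((a : ℚ_[p]) ^ 2 * f x) ∂μ = 0 := by
  obtain ⟨τ, hτ, hψτ⟩ := ψ.exists_forall_norm_le_eq_one hψ
  obtain ⟨t, ht⟩ := hψ1
  obtain ⟨M, hM, ρ, hρ, htay⟩ := hUc.exists_norm_taylor_one_le hUo hf
  obtain ⟨c, hc, hlow⟩ := hUc.exists_mul_le_norm_fderiv hf fun x hx hx0 ↦ hnd x ((hs x).2 ⟨hx, hx0⟩)
  set η := √(τ / M) with hη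
  have hη0 : 0 < η := Real.sqrt_pos.2 (by positivity)
  have hMη : M * η ^ 2 = τ := by
    rw [hη, Real.sq_sqrt (by positivity)]; field_simp
  set R := η + 2 * ‖t‖ / (c * η) with hR
  have hR0 : 0 < R := by positivity
  refine ⟨R, hR0, ?_⟩
  filter_upwards [(tendsto_div_norm_units R).eventually_le_const hρ,
    (tendsto_div_norm_units R).eventually_le_const one_pos] with a hRρ hR1
  set N := ‖(a : ℚ_[p])‖ with hN
  have hN0 : 0 < N := norm_pos_iff.2 a.ne_zero
  have hηR : η / N ≤ R / N := by
    gcongr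
    rw [hR]
    exact le_add_of_nonneg_right (by positivity)
  set W := U \ ⋃ x₀ ∈ s, closedBall x₀ (R / N) with hW
  have hballs : IsClopen (⋃ x₀ ∈ s, closedBall x₀ (R / N)) :=
    s.finite_toSet.isClopen_biUnion fun x₀ _ ↦
      IsUltrametricDist.isClopen_closedBall x₀ (by positivity)
  have hWcl : IsClopen W := IsClopen.diff ⟨hUc.isClosed, hUo⟩ hballs
  have hWc : IsCompact W := hUc.diff hballs.isOpen
  have hWinv : ∀ y ∈ W, ∀ h : Fin n → ℚ_[p], ‖h‖ ≤ η / N → y + h ∈ W := by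
    intro y hy h hh
    refine ⟨(htay y hy.1 h (hh.trans (hηR.trans hRρ))).1, fun hmem ↦ hy.2 ?_⟩
    simp only [mem_iUnion, mem_closedBall, exists_prop] at hmem ⊢
    obtain ⟨x₀, hx₀, hd⟩ := hmem
    refine ⟨x₀, hx₀, (IsUltrametricDist.dist_triangle_max y (y + h) x₀).trans (max_le ?_ hd)⟩
    rw [dist_self_add_right]
    exact hh.trans hηR
  set g : (Fin n → ℚ_[p]) → ℂ := fun x ↦ ψ ((a : ℚ_[p]) ^ 2 * f x)
  have hgc : ContinuousOn g W :=
    hψ.comp_continuousOn (continuousOn_const.mul (hf.continuousOn.mono sdiff_subset))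
  have hGc : Continuous (W.indicator g) :=
    continuous_indicator (by simp [hWcl.frontier_eq]) (by rwa [hWcl.isClosed.closure_eq])
  rw [← integral_indicator hWcl.isClosed.measurableSet]
  refine integral_eq_zero_of_forall_exists_eq_mul hGc
    (HasCompactSupport.intro hWc fun x hx ↦ indicator_of_notMem hx _)
    (div_pos hη0 hN0) fun y ↦ ?_
  by_cases hy : y ∈ W
  · have hexp : ∀ h : Fin n → ℚ_[p], ‖h‖ ≤ η / N →
        W.indicator g (y + h) = g y * ψ ((a : ℚ_[p]) ^ 2 * fderiv ℚ_[p] f y h) := by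
      intro h hh
      rw [indicator_of_mem (hWinv y hy h hh)]
      have hsmall : ‖(a : ℚ_[p]) ^ 2 * (f (y + h) - f y - fderiv ℚ_[p] f y h)‖ ≤ τ := by
        rw [norm_mul, norm_pow, ← hN]
        calc N ^ 2 * _ ≤ N ^ 2 * (M * (η / N) ^ 2) := by
              gcongr
              refine (htay y hy.1 h (hh.trans (hηR.trans hRρ))).2.trans ?_
              gcongr
          _ = M * η ^ 2 := by field_simp
          _ ≤ τ := hMη.le
      have := hψτ _ hsmall
      simp only [g]
      rw [← ψ.map_add_eq_mul, ← mul_one (ψ (_ + _)), ← this, ← ψ.map_add_eq_mul]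
      congr 1
      ring
    have hdf : c * (R / N) ≤ ‖fderiv ℚ_[p] f y‖ := by
      refine hlow y hy.1 _ (by positivity) hR1 fun x hx hx0 ↦ not_le.1 fun hle ↦ hy.2 ?_
      simp only [mem_iUnion, mem_closedBall, exists_prop]
      exact ⟨x, (hs x).2 ⟨hx, hx0⟩, by rwa [dist_eq_norm]⟩
    have hcR : 0 < c * (R / N) := by positivity
    obtain ⟨v, hv⟩ := (fderiv ℚ_[p] f y).exists_mul_lt_of_lt_opNorm (half_pos hcR).le
      ((half_lt_self hcR).trans_le hdf)
    set d := fderiv ℚ_[p] f y v with hd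
    have hdpos : 0 < ‖d‖ := lt_of_le_of_lt (by positivity) hv
    have hd0 : d ≠ 0 := norm_pos_iff.1 hdpos
    have ha0 : (a : ℚ_[p]) ≠ 0 := a.ne_zero
    set h₀ : Fin n → ℚ_[p] := (t / ((a : ℚ_[p]) ^ 2 * d)) • v with hh₀
    have hh₀' : (a : ℚ_[p]) ^ 2 * fderiv ℚ_[p] f y h₀ = t := by
      rw [hh₀, map_smul, smul_eq_mul, ← hd]
      field_simp
    have hh₀n : ‖h₀‖ ≤ η / N := by
      rw [hh₀, norm_smul, norm_div, norm_mul, norm_pow, ← hN]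
      have hRt : 2 * ‖t‖ ≤ R * (c * η) := by
        rw [hR, add_mul, div_mul_cancel₀ _ (by positivity)]
        exact le_add_of_nonneg_left (by positivity)
      have hvd : R * c * ‖v‖ ≤ 2 * N * ‖d‖ := by
        have : R * c * ‖v‖ = 2 * N * (c * (R / N) / 2 * ‖v‖) := by field_simp
        rw [this]
        gcongr
      rw [div_mul_eq_mul_div, div_le_div_iff₀ (by positivity) hN0]
      have h1 : 2 * (‖t‖ * ‖v‖) ≤ 2 * (η * (N * ‖d‖)) := by
        calc 2 * (‖t‖ * ‖v‖) = 2 * ‖t‖ * ‖v‖ := by ring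
          _ ≤ R * (c * η) * ‖v‖ := by gcongr
          _ = η * (R * c * ‖v‖) := by ring
          _ ≤ η * (2 * N * ‖d‖) := by gcongr
          _ = _ := by ring
      nlinarith
    refine ⟨h₀, hh₀n, ψ t, ht, fun h hh ↦ ?_⟩
    rw [hexp h hh, hexp (h + h₀) ((IsUltrametricDist.norm_add_le_max _ _).trans (max_le hh hh₀n)),
      map_add, mul_add, hh₀', ψ.map_add_eq_mul]
    ring
  · refine ⟨0, by simpa using (div_pos hη0 hN0).le, 0, zero_ne_one, fun h hh ↦ ?_⟩
    rw [add_zero, zero_mul, indicator_of_notMem]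
    intro hmem
    have := hWinv _ hmem (-h) (by rwa [norm_neg])
    rw [add_neg_cancel_right] at this
    exact hy this

end Padic

/-- Stationary phase over `ℚ_p`: if `f` is analytic on an open set containing the
compact open set `U` and the set `Cr` of critical points of `f` in `U` is finite with
all critical points nondegenerate, then for `a ∈ ℚ_pˣ` with `‖a‖` large enough,
`∫_U ψ(a² f(x)) dμ(x) = ∑_{x₀ ∈ Cr} ψ(a² f(x₀)) ‖a‖^{-n} c(x₀)`
for suitable constants `c(x₀)`. -/
theorem stationary_phase_padic (p : ℕ) [Fact p.Prime] (n : ℕ)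
    [MeasurableSpace (Fin n → ℚ_[p])] [BorelSpace (Fin n → ℚ_[p])]
    (μ : Measure (Fin n → ℚ_[p])) [μ.IsAddHaarMeasure]
    (U O : Set (Fin n → ℚ_[p])) (hUc : IsCompact U) (hUo : IsOpen U)
    (hO : IsOpen O) (hUO : U ⊆ O)
    (f : (Fin n → ℚ_[p]) → ℚ_[p]) (hf : AnalyticOnNhd ℚ_[p] f O)
    (Cr : Set (Fin n → ℚ_[p])) (hCr : Cr = {x ∈ U | fderiv ℚ_[p] f x = 0})
    (hfin : Cr.Finite)
    (hnd : ∀ x₀ ∈ Cr, ∀ v : Fin n → ℚ_[p], v ≠ 0 →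
      ∃ w : Fin n → ℚ_[p], (fderiv ℚ_[p] (fderiv ℚ_[p] f) x₀ v) w ≠ 0)
    (ψ : AddChar ℚ_[p] ℂ) (hψc : Continuous ψ) (hψ : ∃ x, ψ x ≠ 1) :
    ∃ (C : ℝ) (c : (Fin n → ℚ_[p]) → ℂ), 0 < C ∧ ∀ a : ℚ_[p]ˣ, C ≤ ‖(a : ℚ_[p])‖ →
      ∫ x in U, ψ ((a : ℚ_[p]) ^ 2 * f x) ∂μ =
        ∑ x₀ ∈ hfin.toFinset,
          ψ ((a : ℚ_[p]) ^ 2 * f x₀) * ((‖(a : ℚ_[p])‖ : ℂ) ^ (-(n : ℤ))) * c x₀ := by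
  have hfU : AnalyticOnNhd ℚ_[p] f U := hf.mono hUO
  have hs : ∀ x, x ∈ hfin.toFinset ↔ x ∈ U ∧ fderiv ℚ_[p] f x = 0 := by simp [hCr]
  have hinj : ∀ x ∈ hfin.toFinset, Function.Injective (fderiv ℚ_[p] (fderiv ℚ_[p] f) x) := by
    intro x hx
    refine (injective_iff_map_eq_zero _).2 fun v hv ↦ by_contra fun hv0 ↦ ?_
    obtain ⟨w, hw⟩ := hnd x (hfin.mem_toFinset.1 hx) v hv0
    exact hw (by rw [hv, zero_apply])
  obtain ⟨R, hR, hout⟩ := Padic.exists_eventually_setIntegral_diff_eq_zero μ hUc hUo hfU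
    hfin.toFinset hs hinj ψ hψc hψ
  have hin : ∀ x₀ : Fin n → ℚ_[p], ∃ c : ℂ, x₀ ∈ hfin.toFinset →
      ∀ᶠ a : ℚ_[p]ˣ in comap (fun a : ℚ_[p]ˣ ↦ ‖(a : ℚ_[p])‖) atTop,
        ∫ x in closedBall x₀ (R / ‖(a : ℚ_[p])‖), ψ ((a : ℚ_[p]) ^ 2 * f x) ∂μ =
          ψ ((a : ℚ_[p]) ^ 2 * f x₀) * ((‖(a : ℚ_[p])‖ : ℂ) ^ (-(n : ℤ))) * c := by
    intro x₀
    by_cases hx₀ : x₀ ∈ hfin.toFinset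
    · obtain ⟨hxU, hx0⟩ := (hs x₀).1 hx₀
      obtain ⟨c, hc⟩ :=
        Padic.exists_eventually_setIntegral_closedBall_eq μ (hfU x₀ hxU) hx0 ψ hψc hR
      exact ⟨c, fun _ ↦ hc⟩
    · exact ⟨0, fun h ↦ absurd h hx₀⟩
  choose c hc using hin
  have hsub : ∀ᶠ a : ℚ_[p]ˣ in comap (fun a : ℚ_[p]ˣ ↦ ‖(a : ℚ_[p])‖) atTop,
      ∀ x₀ ∈ hfin.toFinset, closedBall x₀ (R / ‖(a : ℚ_[p])‖) ⊆ U := by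
    refine (Filter.eventually_all_finset _).2 fun x₀ hx₀ ↦ ?_
    obtain ⟨ε, hε, hball⟩ := Metric.nhds_basis_closedBall.mem_iff.1
      (hUo.mem_nhds ((hs x₀).1 hx₀).1)
    filter_upwards [(Padic.tendsto_div_norm_units R).eventually_le_const hε] with a ha
    exact (closedBall_subset_closedBall ha).trans hball
  have hdisj : ∀ᶠ a : ℚ_[p]ˣ in comap (fun a : ℚ_[p]ˣ ↦ ‖(a : ℚ_[p])‖) atTop,
      ∀ x ∈ hfin.toFinset, ∀ y ∈ hfin.toFinset, x ≠ y → R / ‖(a : ℚ_[p])‖ < dist x y := by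
    refine (Filter.eventually_all_finset _).2 fun x _ ↦
      (Filter.eventually_all_finset _).2 fun y _ ↦ ?_
    by_cases hxy : x = y
    · exact Eventually.of_forall fun a h ↦ absurd hxy h
    · filter_upwards [(Padic.tendsto_div_norm_units R).eventually_lt_const (dist_pos.2 hxy)]
        with a ha _ using ha
  have hmain : ∀ᶠ a : ℚ_[p]ˣ in comap (fun a : ℚ_[p]ˣ ↦ ‖(a : ℚ_[p])‖) atTop,
      ∫ x in U, ψ ((a : ℚ_[p]) ^ 2 * f x) ∂μ = ∑ x₀ ∈ hfin.toFinset,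
        ψ ((a : ℚ_[p]) ^ 2 * f x₀) * ((‖(a : ℚ_[p])‖ : ℂ) ^ (-(n : ℤ))) * c x₀ := by
    filter_upwards [hout, (Filter.eventually_all_finset _).2 hc, hsub, hdisj]
      with a hout hc hsub hdisj
    have hint : IntegrableOn (fun x ↦ ψ ((a : ℚ_[p]) ^ 2 * f x)) U μ :=
      (hψc.comp_continuousOn (continuousOn_const.mul hfU.continuousOn)).integrableOn_compact hUc
    have hmeas : MeasurableSet (⋃ x₀ ∈ hfin.toFinset, closedBall x₀ (R / ‖(a : ℚ_[p])‖)) :=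
      Finset.measurableSet_biUnion _ fun _ _ ↦ isClosed_closedBall.measurableSet
    rw [← integral_inter_add_sdiff hmeas hint, hout, add_zero,
      inter_eq_self_of_subset_right (iUnion₂_subset hsub), integral_biUnion_finset _
        (fun _ _ ↦ isClosed_closedBall.measurableSet) ?_ fun x hx ↦ hint.mono_set (hsub x hx)]
    · exact Finset.sum_congr rfl hc
    · refine fun x hx y hy hxy ↦ Set.disjoint_left.2 fun z hzx hzy ↦ ?_
      refine (hdisj x hx y hy hxy).not_ge ((IsUltrametricDist.dist_triangle_max x z y).trans ?_)
      exact max_le (by rwa [dist_comm]) hzy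
  obtain ⟨C, -, hC⟩ := ((atTop_basis (α := ℝ)).comap _).eventually_iff.1 hmain
  exact ⟨max C 1, c, by positivity, fun a ha ↦ hC ((le_max_left C 1).trans ha)⟩
end

section
/- Fix a prime p and a natural number n ≥ 1. Let μ be an additive Haar measure on V = Fin n → ℚ_p, let q be a quadratic form on V over ℚ_p whose associated bilinear form is nondegenerate, let U ⊆ V be a compact open additive subgroup, and let ψ : ℚ_p → ℂ be a continuous nontrivial additive character. Then there exist a nonzero constant c ∈ ℂ and C > 0 such that for every a ∈ ℚ_pˣ with ‖a‖ ≥ C, ∫_{x ∈ U} ψ( a² · q(x) ) dμ(x) = c · ‖a‖^{−n}. -/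
open MeasureTheory

open scoped Pointwise Topology NNReal ENNReal

section Fubini

variable {V : Type*} [NormedAddCommGroup V] [MeasurableSpace V] [BorelSpace V]
  (μ : Measure V) [μ.IsAddHaarMeasure]

theorem setIntegral_addSubgroup_add_right (K : AddSubgroup V) (hK : MeasurableSet (K : Set V))
    (f : V → ℂ) {y : V} (hy : y ∈ K) :
    ∫ x in (K : Set V), f (x + y) ∂μ = ∫ x in (K : Set V), f x ∂μ := by
  rw [← integral_indicator hK, ← integral_indicator hK,
    ← integral_add_right_eq_self ((K : Set V).indicator f) y]
  refine integral_congr_ae (.of_forall fun x => ?_)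
  have : x + y ∈ (K : Set V) ↔ x ∈ (K : Set V) := K.add_mem_cancel_right hy
  change (K : Set V).indicator _ x = (K : Set V).indicator f (x + y)
  by_cases hx : x ∈ (K : Set V)
  · rw [Set.indicator_of_mem hx, Set.indicator_of_mem (this.2 hx)]
  · rw [Set.indicator_of_notMem hx, Set.indicator_of_notMem (this.not.2 hx)]

open Classical in
theorem setIntegral_addChar (L : AddSubgroup V) (hL : MeasurableSet (L : Set V))
    (χ : AddChar V ℂ) :
    ∫ y in (L : Set V), χ y ∂μ = if ∀ y ∈ L, χ y = 1 then (μ.real L : ℂ) else 0 := by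
  split_ifs with h
  · rw [setIntegral_congr_fun (g := fun _ => 1) hL (fun y hy => h y hy)]
    simp
  · push Not at h
    obtain ⟨y, hy, hne⟩ := h
    have := setIntegral_addSubgroup_add_right μ L hL χ hy
    simp_rw [AddChar.map_add_eq_mul] at this
    rw [integral_mul_const] at this
    have h2 : (∫ x in (L : Set V), χ x ∂μ) * (χ y - 1) = 0 := by
      rw [mul_sub, this]; ring
    exact (mul_eq_zero.1 h2).resolve_right (sub_ne_zero.2 hne)

/-- If `f (x + y) g y = f x β(x, y)` with `β` additive in `y`, then the product of the integral of
`f` over `K` and of `g` over `L ≤ K` localizes on the orthogonal of `L` with respect to `β`. -/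
theorem setIntegral_mul_setIntegral_eq [SecondCountableTopology V] [ProperSpace V]
    (K L : AddSubgroup V) (hLK : L ≤ K)
    (hKc : IsCompact (K : Set V)) (hLc : IsCompact (L : Set V))
    (f g : V → ℂ) (hf : Continuous f) (hg : Continuous g) (β : V → AddChar V ℂ)
    (hβ : ∀ y, Continuous fun x => β x y) (hfg : ∀ x y, f (x + y) * g y = f x * β x y) :
    (∫ x in (K : Set V), f x ∂μ) * ∫ y in (L : Set V), g y ∂μ =
      μ.real L * ∫ x in (K : Set V) ∩ {x | ∀ y ∈ L, β x y = 1}, f x ∂μ := by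
  classical
  have hK := hKc.isClosed.measurableSet
  have hL := hLc.isClosed.measurableSet
  have hP : MeasurableSet {x | ∀ y ∈ L, β x y = 1} := by
    simp only [Set.ofPred_forall]
    exact (isClosed_biInter fun y _ => isClosed_eq (hβ y) continuous_const).measurableSet
  have hint : Integrable (Function.uncurry fun y x => f (x + y) * g y)
      ((μ.restrict L).prod (μ.restrict K)) := by
    rw [Measure.prod_restrict]
    refine ContinuousOn.integrableOn_compact (hLc.prod hKc) (Continuous.continuousOn ?_)
    exact (hf.comp (continuous_snd.add continuous_fst)).mul (hg.comp continuous_fst)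
  calc (∫ x in (K : Set V), f x ∂μ) * ∫ y in (L : Set V), g y ∂μ
      = ∫ y in (L : Set V), ∫ x in (K : Set V), f (x + y) * g y ∂μ ∂μ := by
        rw [← integral_const_mul]
        refine setIntegral_congr_fun hL fun y hy => ?_
        simp only [integral_mul_const]
        rw [setIntegral_addSubgroup_add_right μ K hK f (hLK hy)]
    _ = ∫ x in (K : Set V), ∫ y in (L : Set V), f (x + y) * g y ∂μ ∂μ :=
        integral_integral_swap hint
    _ = ∫ x in (K : Set V), ({x | ∀ y ∈ L, β x y = 1}.indicator fun x => μ.real L * f x) x ∂μ := by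
        refine integral_congr_ae (.of_forall fun x => ?_)
        simp only [hfg, integral_const_mul]
        rw [setIntegral_addChar μ L hL]
        simp only [Set.indicator, Set.mem_ofPred_eq]
        split_ifs <;> ring
    _ = _ := by
        rw [setIntegral_indicator hP, integral_const_mul]

end Fubini

theorem AddChar.exists_forall_norm_lt_eq_one {p : ℕ} [Fact p.Prime] (ψ : AddChar ℚ_[p] ℂ)
    (hψ : Continuous ψ) : ∃ δ > 0, ∀ x, ‖x‖ < δ → ψ x = 1 := by
  obtain ⟨δ, hδ, h⟩ := Metric.continuousAt_iff.1 (hψ.continuousAt (x := 0)) (1 / 2) (by norm_num)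
  refine ⟨δ, hδ, fun x hx => ?_⟩
  have hsmall : ∀ k : ℕ, ‖ψ x ^ 2 ^ k - 1‖ < 1 / 2 := fun k => by
    have hk : ‖((2 ^ k : ℕ) : ℚ_[p]) * x‖ < δ := by
      rw [norm_mul]
      have := Padic.norm_int_le_one (p := p) ((2 ^ k : ℕ) : ℤ)
      rw [Int.cast_natCast] at this
      nlinarith [norm_nonneg x]
    have := h (x := ((2 ^ k : ℕ) : ℚ_[p]) * x) (by simpa using hk)
    rwa [← nsmul_eq_mul, AddChar.map_nsmul_eq_pow, AddChar.map_zero_eq_one, dist_eq_norm] at this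
  have hgrow : ∀ k : ℕ, (3 / 2) ^ k * ‖ψ x - 1‖ ≤ ‖ψ x ^ 2 ^ k - 1‖ := fun k => by
    induction k with
    | zero => simp
    | succ k ih =>
      set w := ψ x ^ 2 ^ k
      have h1 : ψ x ^ 2 ^ (k + 1) - 1 = (w + 1) * (w - 1) := by
        rw [pow_succ, pow_mul]; ring
      have h2 : 3 / 2 ≤ ‖w + 1‖ := by
        have h3 := norm_sub_le (w + 1) (w - 1)
        have h4 : w + 1 - (w - 1) = 2 := by ring
        rw [h4, Complex.norm_ofNat] at h3
        linarith [hsmall k]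
      rw [h1, norm_mul, pow_succ]
      nlinarith [norm_nonneg (w - 1), norm_nonneg (w + 1)]
  by_contra hne
  have hpos : 0 < ‖ψ x - 1‖ := norm_pos_iff.2 (sub_ne_zero.2 hne)
  obtain ⟨k, hk⟩ := pow_unbounded_of_one_lt (1 / 2 / ‖ψ x - 1‖) (by norm_num : (1 : ℝ) < 3 / 2)
  rw [div_lt_iff₀ hpos] at hk
  linarith [hsmall k, hgrow k]

theorem AddChar.isOpen_setOf_eq_one {p : ℕ} [Fact p.Prime] (ψ : AddChar ℚ_[p] ℂ)
    (hψ : Continuous ψ) : IsOpen {x | ψ x = 1} := by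
  obtain ⟨δ, hδ, h⟩ := ψ.exists_forall_norm_lt_eq_one hψ
  refine Metric.isOpen_iff.2 fun x hx => ⟨δ, hδ, fun y hy => ?_⟩
  have := h (y - x) (by simpa [dist_eq_norm] using hy)
  have h2 : ψ (y - x + x) = 1 := by rw [AddChar.map_add_eq_mul, this, hx, one_mul]
  simpa using h2

section Padic

variable {p : ℕ} [Fact p.Prime] {n : ℕ}

theorem Padic.exists_nat_norm_sub_lt_one {x : ℚ_[p]} (hx : ‖x‖ ≤ 1) :
    ∃ k : Fin p, ‖x - (k : ℕ)‖ < 1 := by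
  obtain ⟨x, rfl⟩ : ∃ z : ℤ_[p], (z : ℚ_[p]) = x := ⟨⟨x, hx⟩, rfl⟩
  obtain ⟨k, hk, h⟩ := PadicInt.exists_mem_range (p := p) x
  refine ⟨⟨k, hk⟩, ?_⟩
  rw [IsLocalRing.mem_maximalIdeal, PadicInt.mem_nonunits] at h
  rwa [PadicInt.norm_def, PadicInt.coe_sub, PadicInt.coe_natCast] at h

theorem Padic.fin_eq_of_norm_sub_lt_one {x : ℚ_[p]} {j k : Fin p} (hj : ‖x - (j : ℕ)‖ < 1)
    (hk : ‖x - (k : ℕ)‖ < 1) : j = k := by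
  have h : ‖(((j : ℕ) - (k : ℕ) : ℤ) : ℚ_[p])‖ < 1 := by
    have h1 : (((j : ℕ) - (k : ℕ) : ℤ) : ℚ_[p]) = (x - (k : ℕ)) + -(x - (j : ℕ)) := by
      push_cast; ring
    rw [h1]
    refine (Padic.nonarchimedean _ _).trans_lt (max_lt hk (by rwa [norm_neg]))
  rw [Padic.norm_intCast_lt_one_iff] at h
  have h2 := Int.eq_zero_of_abs_lt_dvd h (by rw [abs_lt]; constructor <;> omega)
  exact Fin.ext (by omega)

theorem Padic.smul_closedBall_pi {u : ℚ_[p]ˣ} (r : ℝ) :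
    u • Metric.closedBall (0 : Fin n → ℚ_[p]) r =
      Metric.closedBall (0 : Fin n → ℚ_[p]) (‖(u : ℚ_[p])‖ * r) := by
  ext x
  rw [Set.mem_smul_set_iff_inv_smul_mem, mem_closedBall_zero_iff, mem_closedBall_zero_iff,
    Units.smul_def, norm_smul, Units.val_inv_eq_inv_val, norm_inv,
    inv_mul_le_iff₀ (norm_pos_iff.2 u.ne_zero)]

theorem Padic.iUnion_vadd_closedBall_pi :
    Metric.closedBall (0 : Fin n → ℚ_[p]) 1 =
      ⋃ v : Fin n → Fin p, (fun i => ((v i : ℕ) : ℚ_[p])) +ᵥ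
        Metric.ball (0 : Fin n → ℚ_[p]) 1 := by
  ext x
  simp only [Set.mem_iUnion, Set.mem_vadd_set_iff_neg_vadd_mem, mem_closedBall_zero_iff,
    mem_ball_zero_iff, vadd_eq_add, pi_norm_lt_iff one_pos, pi_norm_le_iff_of_nonneg zero_le_one,
    neg_add_eq_sub, Pi.sub_apply]
  constructor
  · intro h
    choose v hv using fun i => Padic.exists_nat_norm_sub_lt_one (h i)
    exact ⟨v, hv⟩
  · rintro ⟨v, hv⟩ i
    rw [← sub_add_cancel (x i) ((v i : ℕ) : ℚ_[p])]
    refine (Padic.nonarchimedean _ _).trans (max_le (hv i).le ?_)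
    simpa using Padic.norm_int_le_one (p := p) (v i : ℕ)

theorem Padic.ball_pi_one_eq :
    Metric.ball (0 : Fin n → ℚ_[p]) 1 = Metric.closedBall 0 ((p : ℝ)⁻¹) := by
  ext x
  simp only [mem_closedBall_zero_iff, mem_ball_zero_iff, pi_norm_lt_iff one_pos,
    pi_norm_le_iff_of_nonneg (inv_nonneg.2 (Nat.cast_nonneg (α := ℝ) p))]
  refine forall_congr' fun i => ?_
  have := Padic.norm_le_pow_iff_norm_lt_pow_add_one (x i) (-1)
  simpa using this.symm

theorem Padic.distribHaarChar_pi_s12 (a : ℚ_[p]ˣ) :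
    (distribHaarChar (Fin n → ℚ_[p]) a : ℝ≥0) = ‖(a : ℚ_[p])‖₊ ^ n := by
  borelize (Fin n → ℚ_[p])
  let μ : Measure (Fin n → ℚ_[p]) := Measure.addHaar
  have hp0 : (p : ℚ_[p]) ≠ 0 := Nat.cast_ne_zero.2 (Fact.out : p.Prime).ne_zero
  have hpos : ∀ r : ℝ, 0 < r → μ (Metric.closedBall 0 r) ≠ 0 := fun r hr =>
    (Metric.measure_closedBall_pos μ 0 hr).ne'
  have hfin : ∀ r : ℝ, μ (Metric.closedBall 0 r) ≠ ∞ := fun r =>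
    (isCompact_closedBall 0 r).measure_lt_top.ne
  have hunit : ∀ u : ℚ_[p]ˣ, ‖(u : ℚ_[p])‖ = 1 → distribHaarChar (Fin n → ℚ_[p]) u = 1 :=
    fun u hu => distribHaarChar_eq_of_measure_smul_eq_mul (μ := μ) (hpos 1 one_pos) (hfin 1)
      (by rw [Padic.smul_closedBall_pi, hu]; simp)
  let ϖ : ℚ_[p]ˣ := Units.mk0 p hp0
  have hϖ : distribHaarChar (Fin n → ℚ_[p]) ϖ = ((p : ℝ≥0) ^ n)⁻¹ := by
    have hmeas : μ (Metric.closedBall 0 1) = (p : ℝ≥0∞) ^ n * μ (ϖ • Metric.closedBall 0 1) := by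
      have hball : ϖ • Metric.closedBall (0 : Fin n → ℚ_[p]) 1 = Metric.ball 0 1 := by
        rw [Padic.smul_closedBall_pi, Padic.ball_pi_one_eq]; simp [ϖ]
      rw [hball, Padic.iUnion_vadd_closedBall_pi, measure_iUnion, tsum_fintype]
      · simp_rw [measure_vadd]
        simp
      · intro v w hvw
        refine Set.disjoint_left.2 fun x hv hw => hvw ?_
        simp only [Set.mem_vadd_set_iff_neg_vadd_mem, mem_ball_zero_iff, vadd_eq_add,
          pi_norm_lt_iff one_pos, neg_add_eq_sub, Pi.sub_apply] at hv hw
        exact funext fun i => Padic.fin_eq_of_norm_sub_lt_one (hv i) (hw i)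
      · exact fun v => (Metric.isOpen_ball.vadd _).measurableSet
    refine distribHaarChar_eq_of_measure_smul_eq_mul (μ := μ) (hpos 1 one_pos) (hfin 1) ?_
    have hpn : (p : ℝ≥0) ^ n ≠ 0 := pow_ne_zero _ (Nat.cast_ne_zero.2 (Fact.out : p.Prime).ne_zero)
    rw [hmeas, ← mul_assoc, ENNReal.coe_inv hpn, ENNReal.coe_pow, ENNReal.coe_natCast,
      ENNReal.inv_mul_cancel, one_mul]
    · exact_mod_cast hpn
    · exact ENNReal.pow_ne_top (ENNReal.natCast_ne_top p)
  have hϖn : ‖(ϖ : ℚ_[p])‖₊ = (p : ℝ≥0)⁻¹ := NNReal.eq (by simp [ϖ])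
  let k := (a : ℚ_[p]).valuation
  have ha : ‖(a : ℚ_[p])‖ = ‖(ϖ : ℚ_[p])‖ ^ k := by
    rw [Padic.norm_eq_zpow_neg_valuation a.ne_zero, zpow_neg, ← inv_zpow]
    simp [ϖ, k]
  have hu : distribHaarChar (Fin n → ℚ_[p]) (a * (ϖ ^ k)⁻¹) = 1 := hunit _ <| by
    rw [Units.val_mul, norm_mul, ha, Units.val_inv_eq_inv_val, norm_inv, Units.val_zpow_eq_zpow_val,
      norm_zpow]
    exact mul_inv_cancel₀ (zpow_ne_zero _ (norm_ne_zero_iff.2 ϖ.ne_zero))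
  have hau : a = a * (ϖ ^ k)⁻¹ * ϖ ^ k := by simp
  have han : ‖(a : ℚ_[p])‖₊ = ‖(ϖ : ℚ_[p])‖₊ ^ k := NNReal.eq (by simpa using ha)
  rw [han, hϖn, hau, map_mul, hu, one_mul, map_zpow, hϖ, ← inv_pow]
  rw [← zpow_natCast, ← zpow_natCast, ← zpow_mul, ← zpow_mul, mul_comm]

theorem setIntegral_comp_units_smul [MeasurableSpace (Fin n → ℚ_[p])] [BorelSpace (Fin n → ℚ_[p])]
    (μ : Measure (Fin n → ℚ_[p])) [μ.IsAddHaarMeasure] (f : (Fin n → ℚ_[p]) → ℂ) (a : ℚ_[p]ˣ)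
    (s : Set (Fin n → ℚ_[p])) :
    ∫ x in s, f (a • x) ∂μ = (‖(a : ℚ_[p])‖ : ℂ) ^ (-(n : ℤ)) * ∫ x in a • s, f x ∂μ := by
  have hemb : MeasurableEmbedding fun x : Fin n → ℚ_[p] => a • x :=
    (Homeomorph.smul a).measurableEmbedding
  have hmap : μ.map (fun x => a • x) = (‖(a : ℚ_[p])‖₊ ^ n)⁻¹ • μ := by
    ext t ht
    rw [hemb.map_apply, Set.preimage_smul, ← distribHaarChar_mul, map_inv,
      Padic.distribHaarChar_pi_s12]
    rfl
  have h := hemb.setIntegral_map (μ := μ) f (a • s)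
  rw [Set.preimage_smul, inv_smul_smul, hmap, Measure.restrict_smul, integral_smul_nnreal_measure] at h
  rw [← h, zpow_neg, zpow_natCast, NNReal.smul_def, Complex.real_smul]
  simp
theorem QuadraticMap.continuous_of_pi_padic (q : QuadraticForm ℚ_[p] (Fin n → ℚ_[p])) :
    Continuous q := by
  have h : ∀ x, q x = 2⁻¹ * ∑ i, x i * q.polarBilin.flip (Pi.single i 1) x := fun x => by
    have h1 : q.polarBilin x x = 2 * q x := by
      simp [QuadraticMap.polar_self]
    have h2 : q.polarBilin x x = q.polarBilin x (∑ i, x i • Pi.single i 1) := by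
      congr 1
      exact pi_eq_sum_univ' x
    rw [map_sum] at h2
    simp only [map_smul, smul_eq_mul] at h2
    have h3 : q x = 2⁻¹ * q.polarBilin x x := by rw [h1]; simp
    rw [h3, h2]; rfl
  rw [show (q : (Fin n → ℚ_[p]) → ℚ_[p]) = _ from funext h]
  have hc : ∀ i : Fin n, Continuous fun x : Fin n → ℚ_[p] =>
      x i * q.polarBilin.flip (Pi.single i 1) x := fun i =>
    (continuous_apply i).mul
      (LinearMap.continuous_of_finiteDimensional (q.polarBilin.flip (Pi.single i 1)))
  exact continuous_const.mul (continuous_finsetSum _ fun i _ => hc i)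

/-- The orthogonal of an open subgroup for the pairing `ψ ∘ B` is bounded. -/
theorem exists_forall_norm_le_of_addChar_eq_one
    (B : LinearMap.BilinForm ℚ_[p] (Fin n → ℚ_[p])) (hB : B.Nondegenerate)
    (ψ : AddChar ℚ_[p] ℂ) (hψ : ∃ x, ψ x ≠ 1)
    (W : AddSubgroup (Fin n → ℚ_[p])) (hW : IsOpen (W : Set (Fin n → ℚ_[p]))) :
    ∃ R : ℝ, ∀ x, (∀ u ∈ W, ψ (B x u) = 1) → ‖x‖ ≤ R := by
  obtain ⟨y₀, hy₀⟩ := hψ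
  obtain ⟨r, hr, hrW⟩ := Metric.isOpen_iff.1 hW 0 W.zero_mem
  obtain ⟨c, hc0, hcr⟩ := NormedField.exists_norm_lt ℚ_[p] hr
  let T : (Fin n → ℚ_[p]) →ₗ[ℚ_[p]] (Fin n → ℚ_[p]) :=
    LinearMap.pi fun i => B.flip (Pi.single i 1)
  have hT : LinearMap.ker T = ⊥ := by
    refine LinearMap.ker_eq_bot'.2 fun x hx => hB.1 x fun y => ?_
    have hi : ∀ i, B x (Pi.single i 1) = 0 := fun i => congrFun hx i
    rw [pi_eq_sum_univ' y, map_sum]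
    simp [hi]
  obtain ⟨A, -, hA⟩ := T.exists_antilipschitzWith hT
  refine ⟨A * (‖y₀‖ / ‖c‖), fun x hx => ?_⟩
  have h1 : ‖T x‖ ≤ ‖y₀‖ / ‖c‖ := by
    refine (pi_norm_le_iff_of_nonneg (by positivity)).2 fun i => ?_
    by_contra! hlt
    have hTx : T x i = B x (Pi.single i 1) := rfl
    have hne : T x i ≠ 0 := norm_pos_iff.1 (lt_of_le_of_lt (by positivity) hlt)
    rw [div_lt_iff₀ hc0] at hlt
    refine hy₀ ?_
    have hmem : (y₀ / T x i) • (Pi.single i 1 : Fin n → ℚ_[p]) ∈ W := by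
      refine hrW ?_
      rw [mem_ball_zero_iff, norm_smul]
      have h2 : ‖(Pi.single i 1 : Fin n → ℚ_[p])‖ ≤ 1 := by
        rw [Pi.norm_single]; simp
      have h3 : ‖y₀ / T x i‖ < r := by
        rw [norm_div, div_lt_iff₀ (norm_pos_iff.2 hne)]
        nlinarith [norm_pos_iff.2 hne]
      nlinarith [norm_nonneg (y₀ / T x i)]
    have := hx _ hmem
    rwa [map_smul, smul_eq_mul, ← hTx, div_mul_cancel₀ _ hne] at this
  have h2 := hA.le_mul_norm (map_zero T) x
  exact h2.trans (by gcongr)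

variable (U : AddSubgroup (Fin n → ℚ_[p]))

theorem AddSubgroup.coe_padic_units_smul (a : ℚ_[p]ˣ) :
    ((a • U : AddSubgroup (Fin n → ℚ_[p])) : Set (Fin n → ℚ_[p])) =
      a • (U : Set (Fin n → ℚ_[p])) :=
  AddSubgroup.coe_pointwise_smul a U

theorem exists_units_smul_subset_of_mem_nhds (hU : IsCompact (U : Set (Fin n → ℚ_[p])))
    {N : Set (Fin n → ℚ_[p])} (hN : N ∈ 𝓝 0) :
    ∃ b : ℚ_[p]ˣ, ((b • U : AddSubgroup _) : Set (Fin n → ℚ_[p])) ⊆ N := by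
  obtain ⟨r, hr, hrN⟩ := Metric.mem_nhds_iff.1 hN
  obtain ⟨M, hM, hUM⟩ := hU.isBounded.exists_pos_norm_le
  obtain ⟨b, hb0, hbr⟩ := NormedField.exists_norm_lt ℚ_[p] (div_pos hr hM)
  refine ⟨Units.mk0 b (norm_pos_iff.1 hb0), ?_⟩
  rw [AddSubgroup.coe_padic_units_smul]
  rintro _ ⟨u, hu, rfl⟩
  refine hrN ?_
  rw [mem_ball_zero_iff]
  change ‖b • u‖ < r
  rw [norm_smul]
  rw [lt_div_iff₀ hM] at hbr
  nlinarith [hUM u hu, norm_nonneg b]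

theorem exists_forall_mem_units_smul (hU : IsOpen (U : Set (Fin n → ℚ_[p]))) (R : ℝ) :
    ∃ C > 0, ∀ a : ℚ_[p]ˣ, C ≤ ‖(a : ℚ_[p])‖ → ∀ x, ‖x‖ ≤ R → x ∈ a • U := by
  obtain ⟨r, hr, hrU⟩ := Metric.isOpen_iff.1 hU 0 U.zero_mem
  refine ⟨(|R| + 1) / r, by positivity, fun a ha x hx => ?_⟩
  rw [← SetLike.mem_coe, AddSubgroup.coe_padic_units_smul, Set.mem_smul_set_iff_inv_smul_mem]
  refine hrU ?_
  rw [mem_ball_zero_iff, Units.smul_def, norm_smul, Units.val_inv_eq_inv_val, norm_inv]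
  have ha0 : 0 < ‖(a : ℚ_[p])‖ := norm_pos_iff.2 a.ne_zero
  rw [div_le_iff₀ hr] at ha
  rw [inv_mul_lt_iff₀ ha0]
  linarith [le_abs_self R]


theorem isCompact_padic_units_smul (hU : IsCompact (U : Set (Fin n → ℚ_[p]))) (a : ℚ_[p]ˣ) :
    IsCompact ((a • U : AddSubgroup (Fin n → ℚ_[p])) : Set (Fin n → ℚ_[p])) := by
  rw [AddSubgroup.coe_padic_units_smul]
  exact hU.smul a

theorem isOpen_padic_units_smul (hU : IsOpen (U : Set (Fin n → ℚ_[p]))) (a : ℚ_[p]ˣ) :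
    IsOpen ((a • U : AddSubgroup (Fin n → ℚ_[p])) : Set (Fin n → ℚ_[p])) := by
  rw [AddSubgroup.coe_padic_units_smul]
  exact hU.smul a

/-- The character `y ↦ ψ (polar q x y)`. -/
noncomputable def AddChar.compPolar (ψ : AddChar ℚ_[p] ℂ)
    (q : QuadraticForm ℚ_[p] (Fin n → ℚ_[p])) (x : Fin n → ℚ_[p]) :
    AddChar (Fin n → ℚ_[p]) ℂ :=
  ψ.compAddMonoidHom (q.polarBilin x).toAddMonoidHom

theorem AddChar.compPolar_apply (ψ : AddChar ℚ_[p] ℂ)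
    (q : QuadraticForm ℚ_[p] (Fin n → ℚ_[p])) (x y : Fin n → ℚ_[p]) :
    ψ.compPolar q x y = ψ (q (x + y) - q x - q y) := rfl

/-- The localization identity for the character `ψ ∘ q` of second degree. -/
theorem setIntegral_quadratic_mul_setIntegral_eq [MeasurableSpace (Fin n → ℚ_[p])]
    [BorelSpace (Fin n → ℚ_[p])] (μ : Measure (Fin n → ℚ_[p])) [μ.IsAddHaarMeasure]
    (q : QuadraticForm ℚ_[p] (Fin n → ℚ_[p])) (ψ : AddChar ℚ_[p] ℂ) (hψ : Continuous ψ)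
    (K L : AddSubgroup (Fin n → ℚ_[p])) (hLK : L ≤ K)
    (hK : IsCompact (K : Set (Fin n → ℚ_[p]))) (hL : IsCompact (L : Set (Fin n → ℚ_[p]))) :
    (∫ x in (K : Set (Fin n → ℚ_[p])), ψ (q x) ∂μ) *
        ∫ y in (L : Set (Fin n → ℚ_[p])), ψ (-q y) ∂μ =
      μ.real L * ∫ x in (K : Set (Fin n → ℚ_[p])) ∩ {x | ∀ y ∈ L, ψ.compPolar q x y = 1},
        ψ (q x) ∂μ := by
  have hq := q.continuous_of_pi_padic
  refine setIntegral_mul_setIntegral_eq μ K L hLK hK hL (fun x => ψ (q x)) (fun y => ψ (-q y))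
    (hψ.comp hq) (hψ.comp hq.neg) (ψ.compPolar q) (fun y => ?_) (fun x y => ?_)
  · simp only [AddChar.compPolar_apply]
    fun_prop
  · rw [AddChar.compPolar_apply, ← AddChar.map_add_eq_mul, ← AddChar.map_add_eq_mul]
    congr 1
    ring

end Padic

/-- Base case of the p-adic stationary phase lemma: for a nondegenerate quadratic
form `q` on `ℚ_pⁿ` (`n ≥ 1`), a compact open additive subgroup `U` and a nontrivial
continuous additive character `ψ`, there is a nonzero constant `c` with
`∫_U ψ(a² q(x)) dμ(x) = c ‖a‖⁻ⁿ` for all `a` with `‖a‖` large enough. -/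
theorem stationary_phase_quadratic_form (p : ℕ) [Fact p.Prime] (n : ℕ) (hn : 1 ≤ n)
    [MeasurableSpace (Fin n → ℚ_[p])] [BorelSpace (Fin n → ℚ_[p])]
    (μ : Measure (Fin n → ℚ_[p])) [μ.IsAddHaarMeasure]
    (q : QuadraticForm ℚ_[p] (Fin n → ℚ_[p]))
    (hq : q.polarBilin.Nondegenerate)
    (U : AddSubgroup (Fin n → ℚ_[p]))
    (hUc : IsCompact (U : Set (Fin n → ℚ_[p]))) (hUo : IsOpen (U : Set (Fin n → ℚ_[p])))
    (ψ : AddChar ℚ_[p] ℂ) (hψc : Continuous ψ) (hψ : ∃ x, ψ x ≠ 1) :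
    ∃ c : ℂ, c ≠ 0 ∧ ∃ C : ℝ, 0 < C ∧ ∀ a : ℚ_[p]ˣ, C ≤ ‖(a : ℚ_[p])‖ →
      ∫ x in (U : Set (Fin n → ℚ_[p])), ψ ((a : ℚ_[p]) ^ 2 * q x) ∂μ =
        c * ((‖(a : ℚ_[p])‖ : ℂ) ^ (-(n : ℤ))) := by
  have hqc := q.continuous_of_pi_padic
  have hker := ψ.isOpen_setOf_eq_one hψc
  have hN₀ : {x | ψ (q x) = 1} ∈ 𝓝 (0 : Fin n → ℚ_[p]) :=
    (hker.preimage hqc).mem_nhds (by simp)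
  obtain ⟨b, hb⟩ := exists_units_smul_subset_of_mem_nhds U hUc hN₀
  set L := b • U with hL
  have hLc := isCompact_padic_units_smul U hUc b
  have hLo := isOpen_padic_units_smul U hUo b
  rw [← hL] at hLc hLo
  have hμL : (μ.real L : ℂ) ≠ 0 := by
    rw [Complex.ofReal_ne_zero, measureReal_def, ENNReal.toReal_ne_zero]
    exact ⟨(hLo.measure_pos μ ⟨0, L.zero_mem⟩).ne', hLc.measure_lt_top.ne⟩
  have hL1 : ∫ y in (L : Set (Fin n → ℚ_[p])), ψ (-q y) ∂μ = μ.real L := by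
    rw [setIntegral_congr_fun (g := fun _ => 1) hLo.measurableSet fun y hy => ?_]
    · simp
    · have h1 : ψ (q y) = 1 := hb hy
      have h2 : ψ (-q y + q y) = 1 := by simp
      rwa [AddChar.map_add_eq_mul, h1, mul_one] at h2
  set P := {x | ∀ y ∈ L, ψ.compPolar q x y = 1} with hP
  obtain ⟨R, hR⟩ := exists_forall_norm_le_of_addChar_eq_one q.polarBilin hq ψ hψ L hLo
  obtain ⟨M, hM, hLM⟩ := hLc.isBounded.exists_pos_norm_le
  obtain ⟨C, hC, hCU⟩ := exists_forall_mem_units_smul U hUo (max R M)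
  have hlocal : ∀ a : ℚ_[p]ˣ, C ≤ ‖(a : ℚ_[p])‖ →
      ∫ x in ((a • U : AddSubgroup _) : Set (Fin n → ℚ_[p])), ψ (q x) ∂μ =
        ∫ x in P, ψ (q x) ∂μ := fun a ha => by
    have hLK : L ≤ a • U := fun x hx => hCU a ha x ((hLM x hx).trans (le_max_right _ _))
    have hPK : P ⊆ ((a • U : AddSubgroup _) : Set (Fin n → ℚ_[p])) := fun x hx =>
      hCU a ha x ((hR x hx).trans (le_max_left _ _))
    have h := setIntegral_quadratic_mul_setIntegral_eq μ q ψ hψc (a • U) L hLK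
      (isCompact_padic_units_smul U hUc a) hLc
    rw [hL1, ← hP, Set.inter_eq_self_of_subset_right hPK, mul_comm] at h
    exact mul_left_cancel₀ hμL h
  refine ⟨∫ x in P, ψ (q x) ∂μ, ?_, C, hC, fun a ha => ?_⟩
  · obtain ⟨R', hR'⟩ := exists_forall_norm_le_of_addChar_eq_one q.polarBilin hq ψ hψ U hUo
    obtain ⟨ε, hε, hεN⟩ := Metric.mem_nhds_iff.1 hN₀
    obtain ⟨a, ha⟩ := NormedField.exists_lt_norm ℚ_[p] (max C (R' / ε))
    have ha0 : 0 < ‖a‖ := hC.trans ((le_max_left _ _).trans_lt ha)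
    lift a to ℚ_[p]ˣ using (norm_pos_iff.1 ha0).isUnit
    set K := a • U with hK
    have hKc := isCompact_padic_units_smul U hUc a
    have hKo := isOpen_padic_units_smul U hUo a
    rw [← hK] at hKc hKo
    have hsmul : ∀ u ∈ U, (a : ℚ_[p]) • u ∈ K := fun u hu => by
      rw [← SetLike.mem_coe, hK, AddSubgroup.coe_padic_units_smul]
      exact Set.smul_mem_smul_set hu
    have hperp : ∀ x, (∀ y ∈ K, ψ.compPolar q x y = 1) → ψ (q x) = 1 := fun x hx => by
      have h1 : ‖(a : ℚ_[p]) • x‖ ≤ R' := hR' _ fun u hu => by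
        have := hx _ (hsmul u hu)
        change ψ (q.polarBilin x ((a : ℚ_[p]) • u)) = 1 at this
        rwa [map_smul, ← LinearMap.smul_apply, ← map_smul] at this
      refine hεN ?_
      rw [mem_ball_zero_iff]
      rw [norm_smul] at h1
      have h2 := (le_max_right _ _).trans_lt ha
      rw [div_lt_iff₀ hε] at h2
      exact lt_of_mul_lt_mul_left (h1.trans_lt h2) ha0.le
    have hnhds : (K : Set (Fin n → ℚ_[p])) ∩ {x | ∀ y ∈ K, ψ.compPolar q x y = 1} ∈ 𝓝 0 := by
      refine Filter.inter_mem (hKo.mem_nhds K.zero_mem) ?_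
      refine hKc.eventually_forall_of_forall_eventually fun y hy => ?_
      have hc : Continuous fun z : (Fin n → ℚ_[p]) × (Fin n → ℚ_[p]) =>
          q (z.1 + z.2) - q z.1 - q z.2 := by fun_prop
      exact (hker.preimage hc).mem_nhds (by simp)
    have h := setIntegral_quadratic_mul_setIntegral_eq μ q ψ hψc K K le_rfl hKc hKc
    have hclosed : IsClosed {x | ∀ y ∈ K, ψ.compPolar q x y = 1} := by
      simp only [Set.ofPred_forall, AddChar.compPolar_apply]
      exact isClosed_biInter fun y _ => isClosed_eq (by fun_prop) continuous_const
    rw [setIntegral_congr_fun (g := fun _ => (1 : ℂ))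
      (hKc.isClosed.inter hclosed).measurableSet fun x hx => hperp x hx.2] at h
    intro h0
    rw [hlocal a ((le_max_left _ _).trans ha.le), h0, zero_mul] at h
    simp only [integral_const, measureReal_restrict_apply_univ, Complex.real_smul, mul_one] at h
    refine mul_ne_zero ?_ ?_ h.symm <;>
      rw [Complex.ofReal_ne_zero, measureReal_def, ENNReal.toReal_ne_zero]
    · exact ⟨(hKo.measure_pos μ ⟨0, K.zero_mem⟩).ne', hKc.measure_lt_top.ne⟩
    · exact ⟨(Measure.measure_pos_of_mem_nhds μ hnhds).ne',
        (measure_mono Set.inter_subset_left |>.trans_lt hKc.measure_lt_top).ne⟩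
  · have hqa : ∀ x, (a : ℚ_[p]) ^ 2 * q x = q (a • x) := fun x => by
      rw [Units.smul_def, QuadraticMap.map_smul, smul_eq_mul, sq]
    simp_rw [hqa]
    rw [setIntegral_comp_units_smul μ (fun x => ψ (q x)), ← AddSubgroup.coe_padic_units_smul,
      hlocal a ha, mul_comm]
end
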